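/- arXiv:1911.03026 — 2 statements merged into one kernel-verified Lean document; each statement's English description precedes it below -/
import Mathlib

section
/- Let C be a cycle on n vertices and I a k-path vertex cover of C. If |I| ≥ ⌈n/k⌉ + 1, or if |I| = ⌈n/k⌉ and n is not divisible by k, then there exists a path on k vertices in C containing at least two vertices of I. -/
/-- `I` is a `k`-path vertex cover of the cycle `C_n` on vertices `0, …, n-1`. -/
def CyclePVC (k n : ℕ) (I : Finset ℕ) : Prop :=
  I ⊆ Finset.range n ∧ ∀ a < n, ∃ t < k, (a + t) % n ∈ I

/-- If `|I| ≥ ⌈n/k⌉ + 1`, or `|I| = ⌈n/k⌉` and `k ∤ n`, then some `k`-path of the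
cycle contains at least two vertices of `I`. -/
theorem two_tokens_on_kpath (k n : ℕ) (hk : 2 ≤ k) (hn : k ≤ n) (I : Finset ℕ)
    (hI : CyclePVC k n I)
    (h : (n + k - 1) / k + 1 ≤ I.card ∨ (I.card = (n + k - 1) / k ∧ ¬ k ∣ n)) :
    ∃ a < n, ∃ t₁ t₂ : ℕ, t₁ < t₂ ∧ t₂ < k ∧ (a + t₁) % n ∈ I ∧ (a + t₂) % n ∈ I := by
  obtain ⟨hsub, -⟩ := hI
  have hcard : n < I.card * k := by
    have hd := Nat.div_add_mod (n + k - 1) k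
    have hm := Nat.mod_lt (n + k - 1) (show 0 < k by omega)
    have hle : n ≤ (n + k - 1) / k * k := by
      rw [Nat.mul_comm]; omega
    rcases h with h | ⟨h, hnd⟩
    · have := Nat.mul_le_mul_right k h
      rw [Nat.add_mul] at this
      omega
    · rw [h]
      refine lt_of_le_of_ne hle fun he => hnd ?_
      rw [he]
      exact Nat.dvd_mul_left _ _
  have key : ∀ v ∈ I, ∀ t < k, ((v + (n - t)) % n + t) % n = v := by
    intro v hv t ht
    have hvn := Finset.mem_range.mp (hsub hv)
    rw [Nat.mod_add_mod, show v + (n - t) + t = v + n by omega, Nat.add_mod_right,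
      Nat.mod_eq_of_lt hvn]
  obtain ⟨⟨v, t⟩, hx, ⟨w, u⟩, hy, hne, heq⟩ :=
    Finset.exists_ne_map_eq_of_card_lt_of_maps_to
      (s := I ×ˢ Finset.range k) (t := Finset.range n)
      (f := fun p => (p.1 + (n - p.2)) % n) (by simpa using hcard)
      (fun p _ => Finset.mem_coe.mpr (Finset.mem_range.mpr (Nat.mod_lt _ (by omega))))
  simp only [Finset.mem_product, Finset.mem_range] at hx hy heq
  have h1 := key v hx.1 t hx.2
  have h2 := key w hy.1 u hy.2
  rw [← heq] at h2
  have ha : (v + (n - t)) % n < n := Nat.mod_lt _ (by omega)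
  rcases lt_trichotomy t u with hl | he | hl
  · exact ⟨_, ha, t, u, hl, hy.2, by rw [h1]; exact hx.1, by rw [h2]; exact hy.1⟩
  · subst he
    exact absurd (by rw [← h1, ← h2, h1]) hne
  · exact ⟨_, ha, u, t, hl, hx.2, by rw [h2]; exact hy.1, by rw [h1]; exact hx.1⟩
end

section
/- Let P = v_1 ... v_n be a path, and let I and J be two k-path vertex covers of P with |I| = |J|. Then there exists a TJ-sequence between I and J, i.e., I and J are reconfigurable under token jumping. Moreover, the minimum length of such a sequence is exactly |I Δ J| / 2. -/
/-- `I` is a `k`-path vertex cover of the path `P_n` on vertices `1, …, n`. -/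
def PathPVC (k n : ℕ) (I : Finset ℕ) : Prop :=
  I ⊆ Finset.Icc 1 n ∧ ∀ a : ℕ, 1 ≤ a → a + k ≤ n + 1 → ∃ j ∈ I, a ≤ j ∧ j < a + k

/-- A token-jumping sequence of length `ℓ` between `k`-path vertex covers `I` and `J`
of the path `P_n`. -/
def PathTJSeq (k n : ℕ) (f : ℕ → Finset ℕ) (ℓ : ℕ) (I J : Finset ℕ) : Prop :=
  f 0 = I ∧ f ℓ = J ∧ (∀ i ≤ ℓ, PathPVC k n (f i)) ∧
    ∀ i < ℓ, ∃ x y : ℕ, f i \ f (i + 1) = {x} ∧ f (i + 1) \ f i = {y}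

lemma tj_swap (k n : ℕ) (I J : Finset ℕ) (hI : PathPVC k n I) (hJ : PathPVC k n J) (x y : ℕ)
    (hy : y ∈ J) (hmin : ∀ z ∈ J, z ∉ I → y ≤ z) (hxJ : x ∉ J) (hxy : x < y) :
    PathPVC k n (insert y (I.erase x)) := by
  refine ⟨?_, ?_⟩
  · intro z hz
    rcases Finset.mem_insert.1 hz with rfl | hz
    · exact hJ.1 hy
    · exact hI.1 (Finset.mem_of_mem_erase hz)
  · intro a ha hak
    obtain ⟨i, hi, h1, h2⟩ := hI.2 a ha hak
    by_cases hix : i = x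
    · subst hix
      obtain ⟨z, hz, h3, h4⟩ := hJ.2 a ha hak
      by_cases hzI : z ∈ I
      · refine ⟨z, ?_, h3, h4⟩
        have : z ≠ i := fun h => hxJ (h ▸ hz)
        simp [this, hzI]
      · have := hmin z hz hzI
        exact ⟨y, by simp, by omega, by omega⟩
    · exact ⟨i, by simp [hix, hi], h1, h2⟩

lemma tj_swap_facts (I J : Finset ℕ) (x y : ℕ) (hx : x ∈ I) (hy : y ∈ J) (hxJ : x ∉ J)
    (hyI : y ∉ I) (m : ℕ) (hm : (I \ J).card = m + 1) :
    I \ insert y (I.erase x) = {x} ∧ insert y (I.erase x) \ I = {y} ∧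
    (insert y (I.erase x)).card = I.card ∧ (insert y (I.erase x) \ J).card = m := by
  have hne : x ≠ y := fun h => hxJ (h ▸ hy)
  refine ⟨?_, ?_, ?_, ?_⟩
  · ext z; simp only [Finset.mem_sdiff, Finset.mem_insert, Finset.mem_erase, Finset.mem_singleton]
    grind
  · ext z; simp only [Finset.mem_sdiff, Finset.mem_insert, Finset.mem_erase, Finset.mem_singleton]
    grind
  · rw [Finset.card_insert_of_notMem (by simp [hyI]), Finset.card_erase_add_one hx]
  · have : insert y (I.erase x) \ J = (I \ J).erase x := by
      ext z; simp only [Finset.mem_sdiff, Finset.mem_insert, Finset.mem_erase]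
      grind
    rw [this, Finset.card_erase_of_mem (by simp [hx, hxJ]), hm]; rfl

lemma tj_exists (k n m : ℕ) : ∀ (I J : Finset ℕ), PathPVC k n I → PathPVC k n J →
    I.card = J.card → (I \ J).card = m → ∃ f, PathTJSeq k n f m I J := by
  induction m with
  | zero =>
    intro I J hI hJ hc hm
    have hs : I ⊆ J := by simpa using hm
    have : I = J := Finset.eq_of_subset_of_card_le hs hc.ge
    subst this
    exact ⟨fun _ => I, rfl, rfl, fun _ _ => hI, fun i hi => absurd hi (by omega)⟩
  | succ m ih =>
    intro I J hI hJ hc hm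
    have hm' : (J \ I).card = m + 1 := by rw [← hm]; exact (Finset.card_sdiff_comm hc).symm
    have ne1 : (I \ J).Nonempty := Finset.card_pos.1 (by omega)
    have ne2 : (J \ I).Nonempty := Finset.card_pos.1 (by omega)
    obtain ⟨x, hx, hxm⟩ := Finset.exists_min_image (I \ J) id ne1
    obtain ⟨y, hy, hym⟩ := Finset.exists_min_image (J \ I) id ne2
    simp only [Finset.mem_sdiff, id, and_imp] at hx hy hxm hym
    rcases lt_trichotomy x y with h | h | h
    · have hP := tj_swap k n I J hI hJ x y hy.1 hym hx.2 h
      obtain ⟨a, b, c, d⟩ := tj_swap_facts I J x y hx.1 hy.1 hx.2 hy.2 m hm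
      obtain ⟨f, f0, fl, fP, fs⟩ := ih _ J hP hJ (c.trans hc) d
      refine ⟨fun i => if i = 0 then I else f (i - 1), by simp, by simpa using fl, ?_, ?_⟩
      · intro i hi
        rcases i with _ | i
        · simpa using hI
        · simpa using fP i (by omega)
      · intro i hi
        rcases i with _ | i
        · exact ⟨x, y, by simpa [f0] using a, by simpa [f0] using b⟩
        · simpa using fs i (by omega)
    · exact absurd hx.1 (h ▸ hy.2)
    · have hP := tj_swap k n J I hJ hI y x hx.1 hxm hy.2 h
      obtain ⟨a, b, c, d⟩ := tj_swap_facts J I y x hy.1 hx.1 hy.2 hx.2 m hm'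
      have hc2 := hc.trans c.symm
      obtain ⟨f, f0, fl, fP, fs⟩ := ih I _ hI hP hc2 ((Finset.card_sdiff_comm hc2).trans d)
      refine ⟨fun i => if i ≤ m then f i else J, by simpa using f0, by simp, ?_, ?_⟩
      · intro i hi
        by_cases h : i ≤ m
        · simpa [h] using fP i h
        · simpa [h] using hJ
      · intro i hi
        by_cases h : i < m
        · have h1 : i ≤ m := h.le
          have h2 : i + 1 ≤ m := h
          simp only [h1, h2, if_true]
          exact fs i h
        · have h1 : i = m := by omega
          subst h1
          exact ⟨x, y, by simpa [fl] using b, by simpa [fl] using a⟩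

/-- On a path, two equal-size `k`-path vertex covers are always reconfigurable under
token jumping, and the minimum length of a TJ-sequence is exactly `|I Δ J| / 2`. -/
theorem path_tj_shortest (k n : ℕ) (hk : 2 ≤ k) (hn : k ≤ n) (I J : Finset ℕ)
    (hI : PathPVC k n I) (hJ : PathPVC k n J) (hcard : I.card = J.card) :
    IsLeast {ℓ : ℕ | ∃ f : ℕ → Finset ℕ, PathTJSeq k n f ℓ I J}
      (((I \ J) ∪ (J \ I)).card / 2) := by
  have hd : ((I \ J) ∪ (J \ I)).card / 2 = (I \ J).card := by
    rw [Finset.card_union_of_disjoint disjoint_sdiff_sdiff, ← Finset.card_sdiff_comm hcard]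
    omega
  rw [hd]
  refine ⟨tj_exists k n _ I J hI hJ hcard rfl, ?_⟩
  rintro l ⟨f, f0, fl, -, fs⟩
  have key : ∀ i ≤ l, (I \ f i).card ≤ i := by
    intro i
    induction i with
    | zero => intro _; simp [f0]
    | succ i ih =>
      intro hi
      obtain ⟨x, y, h1, -⟩ := fs i (by omega)
      have hsub : I \ f (i + 1) ⊆ (I \ f i) ∪ (f i \ f (i + 1)) := by
        intro z; simp only [Finset.mem_sdiff, Finset.mem_union]; tauto
      have h2 := (Finset.card_le_card hsub).trans (Finset.card_union_le _ _)
      rw [h1, Finset.card_singleton] at h2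
      have := ih (by omega)
      omega
  simpa [fl] using key l le_rfl
end
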